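/- arXiv:0812.5015 — 9 statements merged into one kernel-verified Lean document; each statement's English description precedes it below -/
import Mathlib

section
/- Suppose f : G → X satisfies ‖Df(x,y)‖ ≤ φ(x,y) for all x, y ∈ G, where φ : G × G → [0,∞) is any function. Then for every x ∈ G one has ‖(1/k³)·f(kx) − f(x)‖ ≤ φ(x,0)/|2k³|, where the division is by the image of k³ in K and |2k³| denotes the norm in K of the image of 2k³. -/
open Filter Topology Finset

theorem stmt0
    {K : Type*} [NormedField K] [CompleteSpace K]
    (hK : IsNonarchimedean (fun r : K => ‖r‖))
    {X : Type*} [NormedAddCommGroup X] [NormedSpace K X] [CompleteSpace X]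
    (hX : IsNonarchimedean (fun u : X => ‖u‖))
    {G : Type*} [AddCommGroup G]
    (k : ℕ) (hk : 1 ≤ k) (h2k : ((2 * k ^ 3 : ℕ) : K) ≠ 0)
    (f : G → X) (φ : G → G → ℝ) (hφ0 : ∀ x y, 0 ≤ φ x y)
    (hf : ∀ x y : G, ‖f (k • x + y) + f (k • x - y) - (k : K) • (f (x + y) + f (x - y)) - ((2 * (k ^ 3 - k) : ℤ) : K) • f x‖ ≤ φ x y) :
    ∀ x : G, ‖((k : K) ^ 3)⁻¹ • f (k • x) - f x‖ ≤ φ x 0 / ‖((2 * k ^ 3 : ℕ) : K)‖ := by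
  intro x
  have hk3 : (k : K) ^ 3 ≠ 0 := fun h => h2k (by push_cast; rw [h, mul_zero])
  have key : ((2 * k ^ 3 : ℕ) : K) • (((k : K) ^ 3)⁻¹ • f (k • x) - f x) =
      f (k • x + 0) + f (k • x - 0) - (k : K) • (f (x + 0) + f (x - 0))
        - ((2 * (k ^ 3 - k) : ℤ) : K) • f x := by
    rw [smul_sub, smul_smul]
    push_cast
    rw [mul_assoc, mul_inv_cancel₀ hk3]
    simp only [add_zero, sub_zero]
    module
  rw [le_div_iff₀ (norm_pos_iff.mpr h2k), mul_comm, ← norm_smul, key]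
  exact hf x 0
end

section
/- Suppose f : G → X satisfies ‖Df(x,y)‖ ≤ φ(x,y) for all x, y ∈ G, where φ : G × G → [0,∞) is any function. Then for every n ≥ 1 and every x ∈ G one has ‖f(kⁿx)/k^{3n} − f(x)‖ ≤ (1/|2k³|) · max{ φ(kⁱx,0)/|k|^{3i} : 0 ≤ i < n }, where division is by the image of k^{3n} in K. -/
open Filter Topology Finset

/-- In an ultrametric normed group, if consecutive terms of a sequence are within `C`, then all terms
are within `C` of the first one. -/
lemma norm_sub_zero_le_of_norm_succ_sub_le {X : Type*} [NormedAddCommGroup X]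
    (hX : IsNonarchimedean (fun u : X => ‖u‖)) (a : ℕ → X) {C : ℝ} (hC : 0 ≤ C) (n : ℕ)
    (h : ∀ i < n, ‖a (i + 1) - a i‖ ≤ C) : ‖a n - a 0‖ ≤ C := by
  induction n with
  | zero => simpa using hC
  | succ n ih =>
    rw [← sub_add_sub_cancel (a (n + 1)) (a n) (a 0)]
    exact (hX _ _).trans (max_le (h n n.lt_succ_self)
      (ih fun i hi => h i (hi.trans n.lt_succ_self)))

/-- Setting `y = 0` in the cubic difference operator leaves `2 f(kx) - 2k³ f(x)`. -/
lemma cubic_difference_zero {K X G : Type*} [CommRing K] [AddCommGroup X] [Module K X]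
    [AddCommGroup G] (k : ℕ) (f : G → X) (x : G) :
    f (k • x + 0) + f (k • x - 0) - (k : K) • (f (x + 0) + f (x - 0))
      - ((2 * (k ^ 3 - k) : ℤ) : K) • f x =
    (2 : K) • f (k • x) - ((2 * k ^ 3 : ℕ) : K) • f x := by
  simp only [add_zero, sub_zero]
  push_cast
  module

/-- A bound on `2 f(kx) - 2k³ f(x)` bounds one step of the rescaling `f(kx) / k³`. -/
lemma norm_inv_cube_smul_sub_le {K X : Type*} [NormedField K] [NormedAddCommGroup X]
    [NormedSpace K X] {k : ℕ} (h2k : ((2 * k ^ 3 : ℕ) : K) ≠ 0) {u v : X} {C : ℝ}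
    (h : ‖(2 : K) • u - ((2 * k ^ 3 : ℕ) : K) • v‖ ≤ C) :
    ‖((k : K) ^ 3)⁻¹ • u - v‖ ≤ 1 / ‖((2 * k ^ 3 : ℕ) : K)‖ * C := by
  have h2 : (2 : K) ≠ 0 := fun h0 => h2k (by push_cast; simp [h0])
  have heq : ((k : K) ^ 3)⁻¹ • u - v =
      ((2 * k ^ 3 : ℕ) : K)⁻¹ • ((2 : K) • u - ((2 * k ^ 3 : ℕ) : K) • v) := by
    rw [smul_sub, inv_smul_smul₀ h2k, smul_smul]
    congr 2
    push_cast
    rw [mul_inv, mul_right_comm, inv_mul_cancel₀ h2, one_mul]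
  rw [heq, norm_smul, norm_inv, one_div]
  gcongr

theorem stmt1
    {K : Type*} [NormedField K] [CompleteSpace K]
    (hK : IsNonarchimedean (fun r : K => ‖r‖))
    {X : Type*} [NormedAddCommGroup X] [NormedSpace K X] [CompleteSpace X]
    (hX : IsNonarchimedean (fun u : X => ‖u‖))
    {G : Type*} [AddCommGroup G]
    (k : ℕ) (hk : 1 ≤ k) (h2k : ((2 * k ^ 3 : ℕ) : K) ≠ 0)
    (f : G → X) (φ : G → G → ℝ) (hφ0 : ∀ x y, 0 ≤ φ x y)
    (hf : ∀ x y : G, ‖f (k • x + y) + f (k • x - y) - (k : K) • (f (x + y) + f (x - y)) - ((2 * (k ^ 3 - k) : ℤ) : K) • f x‖ ≤ φ x y) :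
    ∀ n : ℕ, ∀ hn : 1 ≤ n, ∀ x : G,
      ‖((k : K) ^ (3 * n))⁻¹ • f (k ^ n • x) - f x‖ ≤
        (1 / ‖((2 * k ^ 3 : ℕ) : K)‖) *
          (Finset.range n).sup' (Finset.nonempty_range_iff.mpr (Nat.one_le_iff_ne_zero.mp hn))
            (fun i => φ (k ^ i • x) 0 / ‖(k : K)‖ ^ (3 * i)) := by
  intro n hn x
  have hstep (z : G) :
      ‖((k : K) ^ 3)⁻¹ • f (k • z) - f z‖ ≤ 1 / ‖((2 * k ^ 3 : ℕ) : K)‖ * φ z 0 :=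
    norm_inv_cube_smul_sub_le h2k (cubic_difference_zero (K := K) k f z ▸ hf z 0)
  set c : ℝ := 1 / ‖((2 * k ^ 3 : ℕ) : K)‖
  have hc : 0 ≤ c := by positivity
  set g : ℕ → ℝ := fun i => φ (k ^ i • x) 0 / ‖(k : K)‖ ^ (3 * i)
  have hle (i : ℕ) (hi : i < n) :
      g i ≤ (Finset.range n).sup'
        (Finset.nonempty_range_iff.mpr (Nat.one_le_iff_ne_zero.mp hn)) g :=
    Finset.le_sup' g (Finset.mem_range.mpr hi)
  have hg0 : 0 ≤ g 0 := div_nonneg (hφ0 _ _) (by positivity)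
  have key := norm_sub_zero_le_of_norm_succ_sub_le hX
    (fun i => ((k : K) ^ (3 * i))⁻¹ • f (k ^ i • x))
    (mul_nonneg hc (hg0.trans (hle 0 hn))) n fun i hi => ?_
  · simpa using key
  · refine le_trans ?_ (mul_le_mul_of_nonneg_left (hle i hi) hc)
    have heq : ((k : K) ^ (3 * (i + 1)))⁻¹ • f (k ^ (i + 1) • x)
        - ((k : K) ^ (3 * i))⁻¹ • f (k ^ i • x) =
        ((k : K) ^ (3 * i))⁻¹ • (((k : K) ^ 3)⁻¹ • f (k • k ^ i • x) - f (k ^ i • x)) := by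
      rw [smul_sub, smul_smul, smul_smul, ← mul_inv, ← pow_add, ← pow_succ', mul_add_one]
    rw [heq, norm_smul, norm_inv, norm_pow]
    calc (‖(k : K)‖ ^ (3 * i))⁻¹ * _ ≤ (‖(k : K)‖ ^ (3 * i))⁻¹ * (c * φ (k ^ i • x) 0) := by
          gcongr
          exact hstep _
      _ = c * g i := by
          simp only [g]
          ring
end

section
/- Let φ : G × G → [0,∞) satisfy lim_{n→∞} φ(kⁿx, kⁿy)/|k|^{3n} = 0 for all x, y ∈ G. If f : G → X satisfies ‖Df(x,y)‖ ≤ φ(x,y) for all x, y ∈ G, then for every x ∈ G the sequence n ↦ f(kⁿx)/k^{3n} (division by the image of k^{3n} in K) is a Cauchy sequence in X, and hence converges. -/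
open Filter Topology Finset

theorem norm_two_mul_norm_sub_le
    {K X G : Type*} [NormedField K] [NormedAddCommGroup X] [NormedSpace K X] [AddCommGroup G]
    {k : ℕ} {f : G → X} {φ : G → G → ℝ}
    (hf : ∀ x y : G, ‖f (k • x + y) + f (k • x - y) - (k : K) • (f (x + y) + f (x - y)) - ((2 * (k ^ 3 - k) : ℤ) : K) • f x‖ ≤ φ x y)
    (x : G) : ‖(2 : K)‖ * ‖f (k • x) - (k : K) ^ 3 • f x‖ ≤ φ x 0 := by
  rw [← norm_smul]
  convert hf x 0 using 2
  simp only [add_zero, sub_zero]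
  push_cast
  module

theorem stmt2
    {K : Type*} [NormedField K] [CompleteSpace K]
    (hK : IsNonarchimedean (fun r : K => ‖r‖))
    {X : Type*} [NormedAddCommGroup X] [NormedSpace K X] [CompleteSpace X]
    (hX : IsNonarchimedean (fun u : X => ‖u‖))
    {G : Type*} [AddCommGroup G]
    (k : ℕ) (hk : 1 ≤ k) (h2k : ((2 * k ^ 3 : ℕ) : K) ≠ 0)
    (f : G → X) (φ : G → G → ℝ) (hφ0 : ∀ x y, 0 ≤ φ x y)
    (hφ : ∀ x y : G, Tendsto (fun n : ℕ => φ (k ^ n • x) (k ^ n • y) / ‖(k : K)‖ ^ (3 * n)) atTop (𝓝 0))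
    (hf : ∀ x y : G, ‖f (k • x + y) + f (k • x - y) - (k : K) • (f (x + y) + f (x - y)) - ((2 * (k ^ 3 - k) : ℤ) : K) • f x‖ ≤ φ x y) :
    ∀ x : G, CauchySeq (fun n : ℕ => ((k : K) ^ (3 * n))⁻¹ • f (k ^ n • x)) ∧
      ∃ L : X, Tendsto (fun n : ℕ => ((k : K) ^ (3 * n))⁻¹ • f (k ^ n • x)) atTop (𝓝 L) := by
  intro x
  have hk0 : (k : K) ≠ 0 := by
    intro h
    simp [h] at h2k
  have h2 : (2 : K) ≠ 0 := by
    intro h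
    simp [h] at h2k
  have : IsUltrametricDist X :=
    IsUltrametricDist.isUltrametricDist_of_isNonarchimedean_norm hX
  suffices h : CauchySeq (fun n : ℕ => ((k : K) ^ (3 * n))⁻¹ • f (k ^ n • x)) from
    ⟨h, cauchySeq_tendsto_of_complete h⟩
  apply NonarchimedeanAddGroup.cauchySeq_of_tendsto_sub_nhds_zero
  have hlim := (hφ x 0).const_mul (‖(2 : K)‖ * ‖(k : K)‖ ^ 3)⁻¹
  rw [mul_zero] at hlim
  refine squeeze_zero_norm (fun n => ?_) hlim
  have hstep : ((k : K) ^ (3 * (n + 1)))⁻¹ • f (k ^ (n + 1) • x)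
      - ((k : K) ^ (3 * n))⁻¹ • f (k ^ n • x)
      = ((k : K) ^ (3 * (n + 1)))⁻¹ • (f (k • k ^ n • x) - (k : K) ^ 3 • f (k ^ n • x)) := by
    rw [smul_sub, smul_smul _ ((k : K) ^ 3), pow_succ' k n, mul_smul]
    congr 2
    field_simp
    ring
  have h2' : 0 < ‖(2 : K)‖ := norm_pos_iff.2 h2
  have hk' : 0 < ‖(k : K)‖ := norm_pos_iff.2 hk0
  have hbound := norm_two_mul_norm_sub_le hf (k ^ n • x)
  rw [hstep, norm_smul, norm_inv, norm_pow, smul_zero]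
  calc (‖(k : K)‖ ^ (3 * (n + 1)))⁻¹ * ‖f (k • k ^ n • x) - (k : K) ^ 3 • f (k ^ n • x)‖
      ≤ (‖(k : K)‖ ^ (3 * (n + 1)))⁻¹ * (φ (k ^ n • x) 0 / ‖(2 : K)‖) := by
        gcongr
        rwa [le_div_iff₀' h2']
    _ = (‖(2 : K)‖ * ‖(k : K)‖ ^ 3)⁻¹ * (φ (k ^ n • x) 0 / ‖(k : K)‖ ^ (3 * n)) := by
        rw [mul_add, pow_add]
        field_simp
        ring
end

section
/- Let φ : G × G → [0,∞) satisfy lim_{n→∞} φ(kⁿx, kⁿy)/|k|^{3n} = 0 for all x, y ∈ G, and suppose f : G → X satisfies ‖Df(x,y)‖ ≤ φ(x,y) for all x, y ∈ G. If C : G → X is defined by C(x) = lim_{n→∞} f(kⁿx)/k^{3n} (this limit exists), then C satisfies the cubic functional equation: C(kx+y) + C(kx−y) = k·[C(x+y) + C(x−y)] + 2(k³−k)·C(x) for all x, y ∈ G. -/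
open Filter Topology Finset

theorem stmt3
    {K : Type*} [NormedField K] [CompleteSpace K]
    (hK : IsNonarchimedean (fun r : K => ‖r‖))
    {X : Type*} [NormedAddCommGroup X] [NormedSpace K X] [CompleteSpace X]
    (hX : IsNonarchimedean (fun u : X => ‖u‖))
    {G : Type*} [AddCommGroup G]
    (k : ℕ) (hk : 1 ≤ k) (h2k : ((2 * k ^ 3 : ℕ) : K) ≠ 0)
    (f : G → X) (φ : G → G → ℝ) (hφ0 : ∀ x y, 0 ≤ φ x y)
    (hφ : ∀ x y : G, Tendsto (fun n : ℕ => φ (k ^ n • x) (k ^ n • y) / ‖(k : K)‖ ^ (3 * n)) atTop (𝓝 0))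
    (hf : ∀ x y : G, ‖f (k • x + y) + f (k • x - y) - (k : K) • (f (x + y) + f (x - y)) - ((2 * (k ^ 3 - k) : ℤ) : K) • f x‖ ≤ φ x y)
    (C : G → X)
    (hC : ∀ x : G, Tendsto (fun n : ℕ => ((k : K) ^ (3 * n))⁻¹ • f (k ^ n • x)) atTop (𝓝 (C x))) :
    ∀ x y : G, C (k • x + y) + C (k • x - y) = (k : K) • (C (x + y) + C (x - y)) + ((2 * (k ^ 3 - k) : ℤ) : K) • C x := by
  intro x y
  have hD := (((hC (k • x + y)).add (hC (k • x - y))).sub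
    (((hC (x + y)).add (hC (x - y))).const_smul (k : K))).sub
    ((hC x).const_smul ((2 * (k ^ 3 - k) : ℤ) : K))
  refine sub_eq_zero.mp ?_
  rw [← sub_sub]
  refine tendsto_nhds_unique hD (squeeze_zero_norm (fun n => ?_) (hφ x y))
  have hn := hf (k ^ n • x) (k ^ n • y)
  rw [smul_comm k (k ^ n) x, ← smul_add, ← smul_sub, ← smul_add, ← smul_sub] at hn
  rw [← smul_add, ← smul_add, smul_comm (k : K),
    smul_comm ((2 * (k ^ 3 - k) : ℤ) : K), ← smul_sub, ← smul_sub, norm_smul, norm_inv, norm_pow,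
    div_eq_inv_mul]
  gcongr
end

section
/- (Remark 2.3, special case of Corollary 2.2) Assume the image of k in K has norm |k| < 1. Let p > 3, let δ > 0, let G be a normed space, and let f : G → X satisfy ‖Df(x,y)‖ ≤ δ·(‖x‖^p + ‖y‖^p) for all x, y ∈ G. Then there exists a unique cubic mapping C : G → X such that ‖f(x) − C(x)‖ ≤ δ·‖x‖^p/|2k³| for all x ∈ G. -/
open Filter Topology Finset

/-- The cubic difference operator `f(kx+y) + f(kx-y) - k(f(x+y) + f(x-y)) - 2(k³-k)f(x)`. -/
def cubicDiff (K : Type*) [NormedField K] {X : Type*} [AddCommGroup X] [Module K X]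
    {G : Type*} [AddCommGroup G] (k : ℕ) (f : G → X) (x y : G) : X :=
  f (k • x + y) + f (k • x - y) - (k : K) • (f (x + y) + f (x - y)) -
    ((2 * (k ^ 3 - k) : ℤ) : K) • f x

section CubicDiff

variable {K : Type*} [NormedField K] {X : Type*} [NormedAddCommGroup X] [NormedSpace K X]
  {G : Type*} [NormedAddCommGroup G] {k : ℕ}

theorem cubicDiff_zero_right (f : G → X) (x : G) :
    cubicDiff K k f x 0 = (2 : K) • (f (k • x) - (k : K) ^ 3 • f x) := by
  simp only [cubicDiff, add_zero, sub_zero]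
  push_cast
  module

theorem tendsto_cubicDiff {F : ℕ → G → X} {C : G → X}
    (h : ∀ x, Tendsto (fun n => F n x) atTop (𝓝 (C x))) (x y : G) :
    Tendsto (fun n => cubicDiff K k (F n) x y) atTop (𝓝 (cubicDiff K k C x y)) :=
  (((h _).add (h _)).sub (((h _).add (h _)).const_smul _)).sub ((h _).const_smul _)

theorem cubicDiff_eq_zero_iff (C : G → X) (x y : G) :
    cubicDiff K k C x y = 0 ↔ C (k • x + y) + C (k • x - y) =
      (k : K) • (C (x + y) + C (x - y)) + ((2 * (k ^ 3 - k) : ℤ) : K) • C x := by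
  rw [cubicDiff, sub_sub, sub_eq_zero]

theorem norm_sub_pow_three_smul_le (h2 : (2 : K) ≠ 0) {p : ℝ} (hp : p ≠ 0) {δ : ℝ}
    {f : G → X} (hf : ∀ x y, ‖cubicDiff K k f x y‖ ≤ δ * (‖x‖ ^ p + ‖y‖ ^ p)) (x : G) :
    ‖f (k • x) - (k : K) ^ 3 • f x‖ ≤ δ / ‖(2 : K)‖ * ‖x‖ ^ p := by
  have h := hf x 0
  rw [cubicDiff_zero_right, norm_smul, norm_zero, Real.zero_rpow hp, add_zero] at h
  rw [div_mul_eq_mul_div, le_div_iff₀ (norm_pos_iff.2 h2)]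
  linarith

variable [NormedSpace ℝ G]

theorem cubicDiff_smul_comp_smul (f : G → X) (c : K) (t : ℝ) (x y : G) :
    cubicDiff K k (fun z => c • f (t • z)) x y = c • cubicDiff K k f (t • x) (t • y) := by
  simp only [cubicDiff, smul_add, smul_sub, smul_comm t k]
  module

theorem norm_inv_pow_smul_le (hk : 1 ≤ k) (n : ℕ) (x : G) :
    ‖(k : ℝ)⁻¹ ^ n • x‖ ≤ ‖x‖ := by
  have hk' : (1 : ℝ) ≤ k := by exact_mod_cast hk
  rw [norm_smul, Real.norm_of_nonneg (by positivity)]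
  exact mul_le_of_le_one_left (norm_nonneg _)
    (pow_le_one₀ (by positivity) (inv_le_one_of_one_le₀ hk'))

theorem natCast_smul_inv_pow_succ_smul (hk : 1 ≤ k) (n : ℕ) (x : G) :
    k • ((k : ℝ)⁻¹ ^ (n + 1) • x) = (k : ℝ)⁻¹ ^ n • x := by
  have hk' : (k : ℝ) ≠ 0 := by positivity
  rw [← Nat.cast_smul_eq_nsmul ℝ, smul_smul, pow_succ', mul_inv_cancel_left₀ hk']

theorem eq_pow_smul_of_cubicDiff_eq_zero (hk : 1 ≤ k) (h2 : (2 : K) ≠ 0) {C : G → X}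
    (hC : ∀ x y, cubicDiff K k C x y = 0) (n : ℕ) (x : G) :
    C x = ((k : K) ^ 3) ^ n • C ((k : ℝ)⁻¹ ^ n • x) := by
  induction n with
  | zero => simp
  | succ n ih =>
    have h := hC ((k : ℝ)⁻¹ ^ (n + 1) • x) 0
    rw [cubicDiff_zero_right, smul_eq_zero_iff_right h2, sub_eq_zero,
      natCast_smul_inv_pow_succ_smul hk] at h
    rw [ih, h, smul_smul, pow_succ ((k : K) ^ 3)]

theorem eq_of_cubicDiff_eq_zero_of_norm_sub_le (hk : 1 ≤ k) (h2 : (2 : K) ≠ 0)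
    (hk1 : ‖(k : K)‖ < 1) {p : ℝ} (hp : 0 ≤ p) {B : ℝ} (hB : 0 ≤ B) {C D : G → X}
    (hC : ∀ x y, cubicDiff K k C x y = 0) (hD : ∀ x y, cubicDiff K k D x y = 0)
    (h : ∀ x, ‖C x - D x‖ ≤ B * ‖x‖ ^ p) : C = D := by
  have hr : ‖(k : K) ^ 3‖ < 1 := by
    rw [norm_pow]; exact pow_lt_one₀ (norm_nonneg _) hk1 (by norm_num)
  ext x
  have hle (n : ℕ) : ‖C x - D x‖ ≤ ‖(k : K) ^ 3‖ ^ n * (B * ‖x‖ ^ p) := by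
    rw [eq_pow_smul_of_cubicDiff_eq_zero hk h2 hC n x,
      eq_pow_smul_of_cubicDiff_eq_zero hk h2 hD n x, ← smul_sub, norm_smul, norm_pow]
    gcongr
    exact (h _).trans (by gcongr; exact norm_inv_pow_smul_le hk n x)
  have hlim := (tendsto_pow_atTop_nhds_zero_of_lt_one (norm_nonneg ((k : K) ^ 3)) hr).mul_const
    (B * ‖x‖ ^ p)
  rw [zero_mul] at hlim
  exact sub_eq_zero.1 (norm_le_zero_iff.1 (ge_of_tendsto' hlim hle))

theorem exists_cubicDiff_eq_zero_norm_sub_le [CompleteSpace X]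
    (hX : IsNonarchimedean (fun u : X => ‖u‖)) (hk : 1 ≤ k) (h2 : (2 : K) ≠ 0)
    (hk1 : ‖(k : K)‖ < 1) {p : ℝ} (hp : 0 < p) {δ : ℝ} (hδ : 0 ≤ δ)
    {f : G → X} (hf : ∀ x y, ‖cubicDiff K k f x y‖ ≤ δ * (‖x‖ ^ p + ‖y‖ ^ p)) :
    ∃ C : G → X, (∀ x y, cubicDiff K k C x y = 0) ∧
      ∀ x, ‖f x - C x‖ ≤ δ / ‖(2 : K)‖ * ‖x‖ ^ p := by
  set r := ‖(k : K) ^ 3‖ with hr_def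
  have hr : r < 1 := by
    rw [hr_def, norm_pow]; exact pow_lt_one₀ (norm_nonneg _) hk1 (by norm_num)
  have hr0 : 0 ≤ r := norm_nonneg _
  let F : ℕ → G → X := fun n x => ((k : K) ^ 3) ^ n • f ((k : ℝ)⁻¹ ^ n • x)
  have hstep (x : G) (n : ℕ) : ‖F n x - F (n + 1) x‖ ≤ δ / ‖(2 : K)‖ * ‖x‖ ^ p * r ^ n := by
    have h := norm_sub_pow_three_smul_le h2 hp.ne' hf ((k : ℝ)⁻¹ ^ (n + 1) • x)
    rw [natCast_smul_inv_pow_succ_smul hk] at h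
    simp only [F]
    rw [pow_succ ((k : K) ^ 3) n, mul_smul, ← smul_sub, norm_smul, norm_pow, mul_comm]
    gcongr
    exact h.trans (by gcongr; exact norm_inv_pow_smul_le hk _ x)
  have hcauchy (x : G) : CauchySeq fun n => F n x :=
    cauchySeq_of_le_geometric r _ hr fun n => by
      rw [dist_eq_norm]; exact hstep x n
  choose C hC using fun x => cauchySeq_tendsto_of_complete (hcauchy x)
  refine ⟨C, fun x y => ?_, fun x => ?_⟩
  · have hzero : Tendsto (fun n => cubicDiff K k (F n) x y) atTop (𝓝 0) := by
      have hlim := (tendsto_pow_atTop_nhds_zero_of_lt_one hr0 hr).mul_const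
        (δ * (‖x‖ ^ p + ‖y‖ ^ p))
      rw [zero_mul] at hlim
      refine squeeze_zero_norm (fun n => ?_) hlim
      rw [cubicDiff_smul_comp_smul, norm_smul, norm_pow]
      gcongr
      refine (hf _ _).trans ?_
      gcongr <;> exact norm_inv_pow_smul_le hk n _
    exact tendsto_nhds_unique (tendsto_cubicDiff hC x y) hzero
  · have hbound (n : ℕ) : ‖f x - F n x‖ ≤ δ / ‖(2 : K)‖ * ‖x‖ ^ p := by
      induction n with
      | zero => simp only [F, pow_zero, one_smul, sub_self, norm_zero]; positivity
      | succ n ih =>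
        rw [← sub_add_sub_cancel (f x) (F n x)]
        exact (hX _ _).trans (max_le ih ((hstep x n).trans
          (mul_le_of_le_one_right (by positivity) (pow_le_one₀ hr0 hr.le))))
    exact le_of_tendsto' ((hC x).const_sub (f x)).norm hbound

end CubicDiff

theorem stmt7
    {K : Type*} [NormedField K] [CompleteSpace K]
    (hK : IsNonarchimedean (fun r : K => ‖r‖))
    {X : Type*} [NormedAddCommGroup X] [NormedSpace K X] [CompleteSpace X]
    (hX : IsNonarchimedean (fun u : X => ‖u‖))
    {G : Type*} [NormedAddCommGroup G] [NormedSpace ℝ G]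
    (k : ℕ) (hk : 1 ≤ k) (h2k : ((2 * k ^ 3 : ℕ) : K) ≠ 0)
    (hk1 : ‖(k : K)‖ < 1)
    (p : ℝ) (hp : 3 < p)
    (δ : ℝ) (hδ : 0 < δ)
    (f : G → X)
    (hf : ∀ x y : G, ‖f (k • x + y) + f (k • x - y) - (k : K) • (f (x + y) + f (x - y)) - ((2 * (k ^ 3 - k) : ℤ) : K) • f x‖ ≤ δ * (‖x‖ ^ p + ‖y‖ ^ p)) :
    ∃! C : G → X, (∀ x y : G, C (k • x + y) + C (k • x - y) = (k : K) • (C (x + y) + C (x - y)) + ((2 * (k ^ 3 - k) : ℤ) : K) • C x) ∧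
      ∀ x : G, ‖f x - C x‖ ≤ δ * ‖x‖ ^ p / ‖((2 * k ^ 3 : ℕ) : K)‖ := by
  have hp0 : 0 < p := by linarith
  have h2 : (2 : K) ≠ 0 := by
    rintro h
    apply h2k
    push_cast
    rw [h, zero_mul]
  simp only [← cubicDiff_eq_zero_iff]
  have hnorm : ‖((2 * k ^ 3 : ℕ) : K)‖ ≤ ‖(2 : K)‖ := by
    push_cast
    rw [norm_mul, norm_pow]
    exact mul_le_of_le_one_right (norm_nonneg _) (pow_le_one₀ (norm_nonneg _) hk1.le)
  obtain ⟨C, hC, hfC⟩ := exists_cubicDiff_eq_zero_norm_sub_le hX hk h2 hk1 hp0 hδ.le hf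
  have hfC' (x : G) : ‖f x - C x‖ ≤ δ * ‖x‖ ^ p / ‖((2 * k ^ 3 : ℕ) : K)‖ := by
    refine (hfC x).trans ?_
    rw [div_mul_eq_mul_div]
    exact div_le_div_of_nonneg_left (by positivity) (norm_pos_iff.2 h2k) hnorm
  refine ⟨C, ⟨hC, hfC'⟩, fun D ⟨hD, hfD⟩ => ?_⟩
  refine eq_of_cubicDiff_eq_zero_of_norm_sub_le (B := δ / ‖((2 * k ^ 3 : ℕ) : K)‖)
    hk h2 hk1 hp0.le (by positivity) hD hC fun x => ?_
  rw [div_mul_eq_mul_div, ← sub_add_sub_cancel (D x) (f x)]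
  refine (hX _ _).trans (max_le ?_ (hfC' x))
  exact (norm_sub_rev _ _).trans_le (hfD x)
end

section
/- Suppose f : G → X satisfies f(0) = 0 and ‖Δf(x,y)‖ ≤ ψ(x,y) for all x, y ∈ G, where ψ : G × G → [0,∞) is any function. Then for every n ≥ 1 and every x ∈ G one has ‖f(kⁿx)/k^{4n} − f(x)‖ ≤ (1/|2k⁴|) · max{ ψ(kⁱx,0)/|k|^{4i} : 0 ≤ i < n }, where division is by the image of k^{4n} in K. -/
open Filter Topology Finset

theorem IsNonarchimedean.norm_sub_zero_le_of_forall_norm_succ_sub_le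
    {X : Type*} [SeminormedAddCommGroup X] (hX : IsNonarchimedean (fun u : X => ‖u‖))
    (u : ℕ → X) {C : ℝ} (hC : 0 ≤ C) (n : ℕ) (h : ∀ i < n, ‖u (i + 1) - u i‖ ≤ C) :
    ‖u n - u 0‖ ≤ C := by
  induction n with
  | zero => simpa using hC
  | succ n ih =>
    rw [← sub_add_sub_cancel (u (n + 1)) (u n) (u 0)]
    exact (hX _ _).trans (max_le (h n n.lt_succ_self) (ih fun i hi => h i (hi.trans n.lt_succ_self)))

theorem norm_inv_smul_sub_le_of_norm_quartic_le
    {K : Type*} [NormedField K] {X : Type*} [NormedAddCommGroup X] [NormedSpace K X]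
    {k : ℕ} (h2k : ((2 * k ^ 4 : ℕ) : K) ≠ 0) {a b : X} {c : ℝ}
    (h : ‖a + a - ((k : K) ^ 2) • (b + b) - ((2 * k ^ 2 * (k ^ 2 - 1) : ℤ) : K) • b‖ ≤ c) :
    ‖((k : K) ^ 4)⁻¹ • a - b‖ ≤ 1 / ‖((2 * k ^ 4 : ℕ) : K)‖ * c := by
  have hk : (k : K) ^ 4 ≠ 0 := fun h0 => h2k (by push_cast; rw [h0, mul_zero])
  have key : a + a - ((k : K) ^ 2) • (b + b) - ((2 * k ^ 2 * (k ^ 2 - 1) : ℤ) : K) • b =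
      ((2 * k ^ 4 : ℕ) : K) • (((k : K) ^ 4)⁻¹ • a - b) := by
    have ha : ((2 * k ^ 4 : ℕ) : K) * ((k : K) ^ 4)⁻¹ = 2 := by
      push_cast
      rw [mul_assoc, mul_inv_cancel₀ hk, mul_one]
    rw [smul_sub, smul_smul, ha]
    push_cast
    module
  rw [key, norm_smul] at h
  rwa [one_div, inv_mul_eq_div, le_div_iff₀' (norm_pos_iff.mpr h2k)]

theorem stmt10
    {K : Type*} [NormedField K] [CompleteSpace K]
    (hK : IsNonarchimedean (fun r : K => ‖r‖))
    {X : Type*} [NormedAddCommGroup X] [NormedSpace K X] [CompleteSpace X]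
    (hX : IsNonarchimedean (fun u : X => ‖u‖))
    {G : Type*} [AddCommGroup G]
    (k : ℕ) (hk : 1 ≤ k) (h2k : ((2 * k ^ 4 : ℕ) : K) ≠ 0)
    (f : G → X) (hf0 : f 0 = 0) (ψ : G → G → ℝ) (hψ0 : ∀ x y, 0 ≤ ψ x y)
    (hf : ∀ x y : G, ‖f (k • x + y) + f (k • x - y) - ((k : K) ^ 2) • (f (x + y) + f (x - y)) - ((2 * k ^ 2 * (k ^ 2 - 1) : ℤ) : K) • f x + ((2 * (k ^ 2 - 1) : ℤ) : K) • f y‖ ≤ ψ x y) :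
    ∀ n : ℕ, ∀ hn : 1 ≤ n, ∀ x : G,
      ‖((k : K) ^ (4 * n))⁻¹ • f (k ^ n • x) - f x‖ ≤
        (1 / ‖((2 * k ^ 4 : ℕ) : K)‖) *
          (Finset.range n).sup' (Finset.nonempty_range_iff.mpr (Nat.one_le_iff_ne_zero.mp hn))
            (fun i => ψ (k ^ i • x) 0 / ‖(k : K)‖ ^ (4 * i)) := by
  intro n hn x
  set S := (Finset.range n).sup' (Finset.nonempty_range_iff.mpr (Nat.one_le_iff_ne_zero.mp hn))
    (fun i => ψ (k ^ i • x) 0 / ‖(k : K)‖ ^ (4 * i))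
  have hS : ∀ i < n, ψ (k ^ i • x) 0 / ‖(k : K)‖ ^ (4 * i) ≤ S := fun i hi =>
    Finset.le_sup' (fun i => ψ (k ^ i • x) 0 / ‖(k : K)‖ ^ (4 * i)) (Finset.mem_range.mpr hi)
  have hS0 : 0 ≤ S := (div_nonneg (hψ0 _ _) (by positivity)).trans (hS 0 hn)
  have hstep (y : G) : ‖((k : K) ^ 4)⁻¹ • f (k • y) - f y‖ ≤
      1 / ‖((2 * k ^ 4 : ℕ) : K)‖ * ψ y 0 :=
    norm_inv_smul_sub_le_of_norm_quartic_le h2k (by simpa [hf0] using hf y 0)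
  have htel := hX.norm_sub_zero_le_of_forall_norm_succ_sub_le
    (fun i => ((k : K) ^ (4 * i))⁻¹ • f (k ^ i • x))
    (C := 1 / ‖((2 * k ^ 4 : ℕ) : K)‖ * S) (by positivity) n fun i hi => by
      have hsplit : ((k : K) ^ (4 * (i + 1)))⁻¹ • f (k ^ (i + 1) • x) -
          ((k : K) ^ (4 * i))⁻¹ • f (k ^ i • x) =
          ((k : K) ^ (4 * i))⁻¹ • (((k : K) ^ 4)⁻¹ • f (k • k ^ i • x) - f (k ^ i • x)) := by
        rw [smul_sub, smul_smul, smul_smul, ← pow_succ', ← mul_inv, ← pow_add, mul_add, mul_one]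
      rw [hsplit, norm_smul, norm_inv, norm_pow]
      calc (‖(k : K)‖ ^ (4 * i))⁻¹ * ‖((k : K) ^ 4)⁻¹ • f (k • k ^ i • x) - f (k ^ i • x)‖
          ≤ (‖(k : K)‖ ^ (4 * i))⁻¹ *
              (1 / ‖((2 * k ^ 4 : ℕ) : K)‖ * ψ (k ^ i • x) 0) := by
            gcongr
            exact hstep _
        _ = 1 / ‖((2 * k ^ 4 : ℕ) : K)‖ * (ψ (k ^ i • x) 0 / ‖(k : K)‖ ^ (4 * i)) := by ring
        _ ≤ 1 / ‖((2 * k ^ 4 : ℕ) : K)‖ * S := by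
            gcongr
            exact hS i hi
  simpa using htel
end

section
/- Let ψ : G × G → [0,∞) satisfy lim_{n→∞} ψ(kⁿx, kⁿy)/|k|^{4n} = 0 for all x, y ∈ G. If f : G → X satisfies f(0) = 0 and ‖Δf(x,y)‖ ≤ ψ(x,y) for all x, y ∈ G, then for every x ∈ G the sequence n ↦ f(kⁿx)/k^{4n} (division by the image of k^{4n} in K) is a Cauchy sequence in X, and hence converges. -/
open Filter Topology Finset

/-- In a normed group with non-Archimedean norm, a sequence whose consecutive differences tend to
zero is Cauchy. -/
theorem IsNonarchimedean.cauchySeq_of_tendsto_norm_sub {X : Type*} [NormedAddCommGroup X]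
    (hX : IsNonarchimedean (fun u : X => ‖u‖)) {a : ℕ → X}
    (ha : Tendsto (fun n => ‖a (n + 1) - a n‖) atTop (𝓝 0)) : CauchySeq a := by
  have : IsUltrametricDist X := IsUltrametricDist.isUltrametricDist_of_forall_norm_add_le_max_norm hX
  exact NonarchimedeanAddGroup.cauchySeq_of_tendsto_sub_nhds_zero
    (tendsto_zero_iff_norm_tendsto_zero.mpr ha)

theorem stmt11
    {K : Type*} [NormedField K] [CompleteSpace K]
    (hK : IsNonarchimedean (fun r : K => ‖r‖))
    {X : Type*} [NormedAddCommGroup X] [NormedSpace K X] [CompleteSpace X]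
    (hX : IsNonarchimedean (fun u : X => ‖u‖))
    {G : Type*} [AddCommGroup G]
    (k : ℕ) (hk : 1 ≤ k) (h2k : ((2 * k ^ 4 : ℕ) : K) ≠ 0)
    (f : G → X) (hf0 : f 0 = 0) (ψ : G → G → ℝ) (hψ0 : ∀ x y, 0 ≤ ψ x y)
    (hψ : ∀ x y : G, Tendsto (fun n : ℕ => ψ (k ^ n • x) (k ^ n • y) / ‖(k : K)‖ ^ (4 * n)) atTop (𝓝 0))
    (hf : ∀ x y : G, ‖f (k • x + y) + f (k • x - y) - ((k : K) ^ 2) • (f (x + y) + f (x - y)) - ((2 * k ^ 2 * (k ^ 2 - 1) : ℤ) : K) • f x + ((2 * (k ^ 2 - 1) : ℤ) : K) • f y‖ ≤ ψ x y) :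
    ∀ x : G, CauchySeq (fun n : ℕ => ((k : K) ^ (4 * n))⁻¹ • f (k ^ n • x)) ∧
      ∃ L : X, Tendsto (fun n : ℕ => ((k : K) ^ (4 * n))⁻¹ • f (k ^ n • x)) atTop (𝓝 L) := by
  intro x
  push_cast at h2k
  have h2 : (2 : K) ≠ 0 := left_ne_zero_of_mul h2k
  have hkK : (k : K) ≠ 0 := fun h => h2k (by simp [h])
  have hbound (y : G) : ‖(2 : K) • f (k • y) - (2 * (k : K) ^ 4) • f y‖ ≤ ψ y 0 := by
    convert hf y 0 using 2
    simp only [add_zero, sub_zero, hf0, smul_zero]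
    push_cast
    module
  have hstep (n : ℕ) : ‖((k : K) ^ (4 * (n + 1)))⁻¹ • f (k ^ (n + 1) • x)
      - ((k : K) ^ (4 * n))⁻¹ • f (k ^ n • x)‖
      ≤ ‖2 * (k : K) ^ 4‖⁻¹ * (ψ (k ^ n • x) (k ^ n • 0) / ‖(k : K)‖ ^ (4 * n)) := by
    have heq : ((k : K) ^ (4 * (n + 1)))⁻¹ • f (k ^ (n + 1) • x)
        - ((k : K) ^ (4 * n))⁻¹ • f (k ^ n • x)
        = ((2 * (k : K) ^ 4)⁻¹ * ((k : K) ^ (4 * n))⁻¹) •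
          ((2 : K) • f (k • k ^ n • x) - (2 * (k : K) ^ 4) • f (k ^ n • x)) := by
      rw [← mul_smul k, ← pow_succ', smul_sub, smul_smul, smul_smul]
      congr 2 <;> field_simp
      ring
    rw [heq, norm_smul, norm_mul, norm_inv, norm_inv, norm_pow, smul_zero, div_eq_inv_mul,
      mul_assoc]
    gcongr
    exact hbound _
  have hlim : Tendsto (fun n : ℕ => ‖2 * (k : K) ^ 4‖⁻¹ *
      (ψ (k ^ n • x) (k ^ n • 0) / ‖(k : K)‖ ^ (4 * n))) atTop (𝓝 0) := by
    simpa only [mul_zero] using (hψ x 0).const_mul ‖2 * (k : K) ^ 4‖⁻¹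
  have hcauchy : CauchySeq (fun n : ℕ => ((k : K) ^ (4 * n))⁻¹ • f (k ^ n • x)) :=
    hX.cauchySeq_of_tendsto_norm_sub (squeeze_zero (fun _ => norm_nonneg _) hstep hlim)
  exact ⟨hcauchy, cauchySeq_tendsto_of_complete hcauchy⟩
end

section
/- Let ψ : G × G → [0,∞) satisfy lim_{n→∞} ψ(kⁿx, kⁿy)/|k|^{4n} = 0 for all x, y ∈ G, and suppose f : G → X satisfies f(0) = 0 and ‖Δf(x,y)‖ ≤ ψ(x,y) for all x, y ∈ G. If Q : G → X is defined by Q(x) = lim_{n→∞} f(kⁿx)/k^{4n} (this limit exists), then Q satisfies the quartic functional equation: Q(kx+y) + Q(kx−y) = k²·[Q(x+y) + Q(x−y)] + 2k²(k²−1)·Q(x) − 2(k²−1)·Q(y) for all x, y ∈ G. -/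
open Filter Topology Finset

theorem stmt12
    {K : Type*} [NormedField K] [CompleteSpace K]
    (hK : IsNonarchimedean (fun r : K => ‖r‖))
    {X : Type*} [NormedAddCommGroup X] [NormedSpace K X] [CompleteSpace X]
    (hX : IsNonarchimedean (fun u : X => ‖u‖))
    {G : Type*} [AddCommGroup G]
    (k : ℕ) (hk : 1 ≤ k) (h2k : ((2 * k ^ 4 : ℕ) : K) ≠ 0)
    (f : G → X) (hf0 : f 0 = 0) (ψ : G → G → ℝ) (hψ0 : ∀ x y, 0 ≤ ψ x y)
    (hψ : ∀ x y : G, Tendsto (fun n : ℕ => ψ (k ^ n • x) (k ^ n • y) / ‖(k : K)‖ ^ (4 * n)) atTop (𝓝 0))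
    (hf : ∀ x y : G, ‖f (k • x + y) + f (k • x - y) - ((k : K) ^ 2) • (f (x + y) + f (x - y)) - ((2 * k ^ 2 * (k ^ 2 - 1) : ℤ) : K) • f x + ((2 * (k ^ 2 - 1) : ℤ) : K) • f y‖ ≤ ψ x y)
    (Q : G → X)
    (hQ : ∀ x : G, Tendsto (fun n : ℕ => ((k : K) ^ (4 * n))⁻¹ • f (k ^ n • x)) atTop (𝓝 (Q x))) :
    ∀ x y : G, Q (k • x + y) + Q (k • x - y) = ((k : K) ^ 2) • (Q (x + y) + Q (x - y)) + ((2 * k ^ 2 * (k ^ 2 - 1) : ℤ) : K) • Q x - ((2 * (k ^ 2 - 1) : ℤ) : K) • Q y := by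
  intro x y
  rw [← sub_eq_zero]
  have hlim := (((((hQ (k • x + y)).add (hQ (k • x - y))).sub
    (((hQ (x + y)).add (hQ (x - y))).const_smul ((k : K) ^ 2))).sub
    ((hQ x).const_smul ((2 * k ^ 2 * (k ^ 2 - 1) : ℤ) : K))).add
    ((hQ y).const_smul ((2 * (k ^ 2 - 1) : ℤ) : K)))
  refine Eq.trans (by abel) (tendsto_nhds_unique hlim (squeeze_zero_norm (fun n => ?_) (hψ x y)))
  have h := hf (k ^ n • x) (k ^ n • y)
  rw [smul_comm k (k ^ n) x, ← smul_add, ← smul_sub, ← smul_add, ← smul_sub] at h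
  simp only [smul_comm _ ((k : K) ^ (4 * n))⁻¹, ← smul_add, ← smul_sub]
  rw [norm_smul, norm_inv, norm_pow, inv_mul_eq_div]
  gcongr
end

section
/- (Remark 3.3, special case of Corollary 3.2) Assume the image of k in K has norm |k| < 1. Let p > 4, let δ > 0, let G be a normed space, and let f : G → X satisfy f(0) = 0 and ‖Δf(x,y)‖ ≤ δ·(‖x‖^p + ‖y‖^p) for all x, y ∈ G. Then there exists a unique quartic mapping Q : G → X such that ‖f(x) − Q(x)‖ ≤ δ·‖x‖^p/|2k⁴| for all x ∈ G. -/
open Filter Topology Finset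

/-- If `f (m x)` is within `B (m x)` of `a • f x`, where `‖a‖ < 1` and `B` decreases along
`x ↦ c • x`, then `a ^ n • f (c ^ n • x)` converges to a function within `B` of `f`. -/
theorem exists_tendsto_pow_smul_of_norm_sub_le {K X G : Type*} [NormedField K]
    [NormedAddCommGroup X] [NormedSpace K X] [CompleteSpace X]
    (hX : IsNonarchimedean (fun u : X => ‖u‖)) [AddCommGroup G] [Module ℝ G]
    {a : K} (ha : ‖a‖ < 1) {c : ℝ} {B : G → ℝ} (hB : ∀ x, B (c • x) ≤ B x) {f : G → X}
    (hf : ∀ x, ‖f x - a • f (c • x)‖ ≤ B x) :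
    ∃ Q : G → X, (∀ x, Tendsto (fun n : ℕ => a ^ n • f (c ^ n • x)) atTop (𝓝 (Q x))) ∧
      ∀ x, ‖f x - Q x‖ ≤ B x := by
  have hB0 : ∀ x, 0 ≤ B x := fun x => (norm_nonneg _).trans (hf x)
  have hBn : ∀ (n : ℕ) x, B (c ^ n • x) ≤ B x := by
    intro n x
    induction n with
    | zero => simp
    | succ n ih => rw [pow_succ', mul_smul]; exact (hB _).trans ih
  have step : ∀ x (n : ℕ),
      ‖a ^ n • f (c ^ n • x) - a ^ (n + 1) • f (c ^ (n + 1) • x)‖ ≤ B x * ‖a‖ ^ n := by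
    intro x n
    rw [pow_succ a, mul_smul, ← smul_sub, norm_smul, norm_pow, pow_succ' c, mul_smul, mul_comm]
    gcongr
    exact (hf _).trans (hBn n x)
  have lim : ∀ x, ∃ q, Tendsto (fun n : ℕ => a ^ n • f (c ^ n • x)) atTop (𝓝 q) := fun x =>
    cauchySeq_tendsto_of_complete (cauchySeq_of_le_geometric ‖a‖ (B x) ha fun n => by
      rw [dist_eq_norm]; exact step x n)
  choose Q hQ using lim
  refine ⟨Q, hQ, fun x => ?_⟩
  refine le_of_tendsto ((tendsto_const_nhds (x := f x)).sub (hQ x)).norm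
    (Eventually.of_forall fun n => ?_)
  induction n with
  | zero => simpa using hB0 x
  | succ n ih =>
    rw [← sub_add_sub_cancel (f x) (a ^ n • f (c ^ n • x))]
    refine (hX _ _).trans (max_le ih ((step x n).trans ?_))
    exact mul_le_of_le_one_right (hB0 x) (pow_le_one₀ (norm_nonneg a) ha.le)

/-- Two solutions of `Q x = a • Q (c • x)` at bounded distance along each orbit of `x ↦ c • x`
coincide when `‖a‖ < 1`. -/
theorem eq_of_eq_smul_of_norm_sub_le {K X G : Type*} [NormedField K]
    [NormedAddCommGroup X] [NormedSpace K X] [AddCommGroup G] [Module ℝ G]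
    {a : K} (ha : ‖a‖ < 1) {c : ℝ} {B : G → ℝ} (hB : ∀ x, B (c • x) ≤ B x) {Q R : G → X}
    (hQ : ∀ x, Q x = a • Q (c • x)) (hR : ∀ x, R x = a • R (c • x))
    (h : ∀ x, ‖Q x - R x‖ ≤ B x) : Q = R := by
  funext x
  have key : ∀ (n : ℕ) x, ‖Q x - R x‖ ≤ ‖a‖ ^ n * B x := by
    intro n
    induction n with
    | zero => simpa using h
    | succ n ih =>
      intro x
      rw [hQ x, hR x, ← smul_sub, norm_smul, pow_succ', mul_assoc]
      gcongr
      exact (ih _).trans (mul_le_mul_of_nonneg_left (hB x) (by positivity))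
  have lim : Tendsto (fun n : ℕ => ‖a‖ ^ n * B x) atTop (𝓝 0) := by
    simpa using (tendsto_pow_atTop_nhds_zero_of_lt_one (norm_nonneg a) ha).mul_const (B x)
  exact sub_eq_zero.1 (norm_le_zero_iff.1 (ge_of_tendsto' lim fun n => key n x))

theorem stmt16
    {K : Type*} [NormedField K] [CompleteSpace K]
    (hK : IsNonarchimedean (fun r : K => ‖r‖))
    {X : Type*} [NormedAddCommGroup X] [NormedSpace K X] [CompleteSpace X]
    (hX : IsNonarchimedean (fun u : X => ‖u‖))
    {G : Type*} [NormedAddCommGroup G] [NormedSpace ℝ G]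
    (k : ℕ) (hk : 1 ≤ k) (h2k : ((2 * k ^ 4 : ℕ) : K) ≠ 0)
    (hk1 : ‖(k : K)‖ < 1)
    (p : ℝ) (hp : 4 < p)
    (δ : ℝ) (hδ : 0 < δ)
    (f : G → X) (hf0 : f 0 = 0)
    (hf : ∀ x y : G, ‖f (k • x + y) + f (k • x - y) - ((k : K) ^ 2) • (f (x + y) + f (x - y)) - ((2 * k ^ 2 * (k ^ 2 - 1) : ℤ) : K) • f x + ((2 * (k ^ 2 - 1) : ℤ) : K) • f y‖ ≤ δ * (‖x‖ ^ p + ‖y‖ ^ p)) :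
    ∃! Q : G → X, (∀ x y : G, Q (k • x + y) + Q (k • x - y) = ((k : K) ^ 2) • (Q (x + y) + Q (x - y)) + ((2 * k ^ 2 * (k ^ 2 - 1) : ℤ) : K) • Q x - ((2 * (k ^ 2 - 1) : ℤ) : K) • Q y) ∧
      ∀ x : G, ‖f x - Q x‖ ≤ δ * ‖x‖ ^ p / ‖((2 * k ^ 4 : ℕ) : K)‖ := by
  have hk0 : (k : ℝ) ≠ 0 := by positivity
  have hkR : (1 : ℝ) ≤ k := by exact_mod_cast hk
  have hp0 : p ≠ 0 := by linarith
  have h2 : (2 : K) ≠ 0 := fun h => h2k (by push_cast; rw [h, zero_mul])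
  set a : K := (k : K) ^ 4 with ha_def
  have ha : ‖a‖ < 1 := by
    rw [norm_pow]; exact pow_lt_one₀ (norm_nonneg _) hk1 (by norm_num)
  have hD : ‖((2 * k ^ 4 : ℕ) : K)‖ = ‖(2 : K)‖ * ‖a‖ := by
    push_cast; rw [norm_mul]
  have hDpos : 0 < ‖((2 * k ^ 4 : ℕ) : K)‖ := norm_pos_iff.2 h2k
  set c : ℝ := (k : ℝ)⁻¹ with hc_def
  have hc0 : 0 ≤ c := by positivity
  have hc1 : c ≤ 1 := inv_le_one_of_one_le₀ hkR
  have hkc : ∀ x : G, k • c • x = x := fun x => by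
    rw [← Nat.cast_smul_eq_nsmul ℝ, smul_smul, hc_def, mul_inv_cancel₀ hk0, one_smul]
  have hpow : ∀ (b : ℝ), 0 ≤ b → b ≤ 1 → ∀ x : G, ‖b • x‖ ^ p ≤ ‖x‖ ^ p := fun b hb0 hb1 x => by
    refine Real.rpow_le_rpow (norm_nonneg _) ?_ (by linarith)
    rw [norm_smul, Real.norm_of_nonneg hb0]
    exact mul_le_of_le_one_left (norm_nonneg x) hb1
  set B : G → ℝ := fun x => δ * ‖x‖ ^ p / ‖((2 * k ^ 4 : ℕ) : K)‖ with hB_def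
  have hB : ∀ x, B (c • x) ≤ B x := fun x => by
    simp only [hB_def]
    gcongr δ * ?_ / _
    exact hpow c hc0 hc1 x
  have diag : ∀ g : G → X, g 0 = 0 → ∀ x,
      g (k • x + 0) + g (k • x - 0) - ((k : K) ^ 2) • (g (x + 0) + g (x - 0))
        - ((2 * k ^ 2 * (k ^ 2 - 1) : ℤ) : K) • g x + ((2 * (k ^ 2 - 1) : ℤ) : K) • g 0
      = (2 : K) • (g (k • x) - a • g x) := fun g hg x => by
    rw [hg, ha_def]
    simp only [add_zero, sub_zero, smul_zero]
    push_cast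
    module
  have hfx : ∀ x, ‖f x - a • f (c • x)‖ ≤ B x := fun x => by
    have h := hf (c • x) 0
    rw [diag f hf0, hkc, norm_smul, norm_zero, Real.zero_rpow hp0, add_zero] at h
    rw [hB_def, le_div_iff₀ hDpos, hD]
    calc ‖f x - a • f (c • x)‖ * (‖(2 : K)‖ * ‖a‖)
        = (‖(2 : K)‖ * ‖f x - a • f (c • x)‖) * ‖a‖ := by ring
      _ ≤ ‖(2 : K)‖ * ‖f x - a • f (c • x)‖ :=
          mul_le_of_le_one_right (by positivity) ha.le
      _ ≤ δ * ‖c • x‖ ^ p := h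
      _ ≤ δ * ‖x‖ ^ p := mul_le_mul_of_nonneg_left (hpow c hc0 hc1 x) hδ.le
  have hom : ∀ Q : G → X, (∀ x y : G, Q (k • x + y) + Q (k • x - y) =
      ((k : K) ^ 2) • (Q (x + y) + Q (x - y)) + ((2 * k ^ 2 * (k ^ 2 - 1) : ℤ) : K) • Q x
        - ((2 * (k ^ 2 - 1) : ℤ) : K) • Q y) → (∀ x, ‖f x - Q x‖ ≤ B x) →
      ∀ x, Q x = a • Q (c • x) := fun Q hQ hQf x => by
    have hQ0 : Q 0 = 0 := by
      have h := hQf 0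
      simpa [hB_def, hf0, Real.zero_rpow hp0] using h
    have h := diag Q hQ0 (c • x)
    rw [hQ (c • x) 0, hkc] at h
    have h' : (2 : K) • (Q x - a • Q (c • x)) = 0 := by
      rw [← h]; abel
    exact sub_eq_zero.1 ((smul_eq_zero.1 h').resolve_left h2)
  obtain ⟨Q, hQ, hQf⟩ := exists_tendsto_pow_smul_of_norm_sub_le hX ha hB hfx
  have hQquartic : ∀ x y : G, Q (k • x + y) + Q (k • x - y) =
      ((k : K) ^ 2) • (Q (x + y) + Q (x - y)) + ((2 * k ^ 2 * (k ^ 2 - 1) : ℤ) : K) • Q x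
        - ((2 * (k ^ 2 - 1) : ℤ) : K) • Q y := fun x y => by
    have lim := ((((hQ (k • x + y)).add (hQ (k • x - y))).sub
      (((hQ (x + y)).add (hQ (x - y))).const_smul ((k : K) ^ 2))).sub
      ((hQ x).const_smul ((2 * k ^ 2 * (k ^ 2 - 1) : ℤ) : K))).add
      ((hQ y).const_smul ((2 * (k ^ 2 - 1) : ℤ) : K))
    have lim0 : Tendsto (fun n : ℕ => ‖a‖ ^ n * (δ * (‖x‖ ^ p + ‖y‖ ^ p))) atTop (𝓝 0) := by
      simpa using (tendsto_pow_atTop_nhds_zero_of_lt_one (norm_nonneg a) ha).mul_const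
        (δ * (‖x‖ ^ p + ‖y‖ ^ p))
    have h0 := tendsto_nhds_unique lim (squeeze_zero_norm (fun n => ?_) lim0)
    · rw [← sub_eq_zero, ← h0]
      abel
    · have h := hf (c ^ n • x) (c ^ n • y)
      rw [smul_comm k (c ^ n) x, ← smul_add, ← smul_sub, ← smul_add, ← smul_sub] at h
      have hn0 : 0 ≤ c ^ n := by positivity
      have hn1 : c ^ n ≤ 1 := pow_le_one₀ hc0 hc1
      have h' := h.trans (mul_le_mul_of_nonneg_left
        (add_le_add (hpow _ hn0 hn1 x) (hpow _ hn0 hn1 y)) hδ.le)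
      refine le_trans (le_of_eq ?_) (mul_le_mul_of_nonneg_left h' (by positivity : 0 ≤ ‖a‖ ^ n))
      rw [← norm_pow, ← norm_smul]
      congr 1
      module
  refine ⟨Q, ⟨hQquartic, hQf⟩, fun R ⟨hR, hRf⟩ => ?_⟩
  refine eq_of_eq_smul_of_norm_sub_le ha hB (hom R hR hRf) (hom Q hQquartic hQf) fun x => ?_
  rw [← sub_add_sub_cancel (R x) (f x)]
  exact (hX _ _).trans (max_le ((norm_sub_rev _ _).trans_le (hRf x)) (hQf x))
end
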